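/- Let A_1, A_2 be positive semidefinite d×d complex matrices and p > 0. On ℂ^{2d} (indexed by Fin 2 × Fin d), let 𝒜 be the block-diagonal matrix diag(A_1, A_2), let σ be the block swap operator (σ(u ⊕ v) = v ⊕ u), and let Π_± = (I ± σ)/2, which are complementary orthogonal projections. Then 2·Tr((A_1^p + A_2^p)^{1/p}) = 2^{1/p}·Tr((Π_+ 𝒜^p Π_+)^{1/p}) + 2^{1/p}·Tr((Π_− 𝒜^p Π_−)^{1/p}). -/

import Mathlib

open Matrix
open scoped ComplexOrder

/-- Matrix power via the functional calculus: for a Hermitian matrix, apply the real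
power `x ^ s` to the eigenvalues in its spectral decomposition (so `0 ^ s = 0` for `s > 0`);
junk value `0` for non-Hermitian matrices. -/
noncomputable def matrixRpow {n : Type*} [Fintype n] [DecidableEq n]
    (A : Matrix n n ℂ) (s : ℝ) : Matrix n n ℂ :=
  if h : A.IsHermitian then
    (h.eigenvectorUnitary : Matrix n n ℂ) *
      Matrix.diagonal (fun i => ((h.eigenvalues i ^ s : ℝ) : ℂ)) *
        (star h.eigenvectorUnitary : Matrix n n ℂ)
  else 0

section MatrixRpow

variable {m n : Type*} [Fintype m] [DecidableEq m] [Fintype n] [DecidableEq n]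

/-- Real powers respect intertwining relations up to a nonnegative scalar. -/
theorem matrixRpow_mul_eq_smul_mul_matrixRpow {A : Matrix m m ℂ} {B : Matrix n n ℂ}
    {X : Matrix m n ℂ} {c : ℝ} (hA : A.IsHermitian) (hB : B.PosSemidef) (hc : 0 ≤ c)
    (h : A * X = (c : ℂ) • (X * B)) (s : ℝ) :
    matrixRpow A s * X = ((c ^ s : ℝ) : ℂ) • (X * matrixRpow B s) := by
  have hB' := hB.isHermitian
  rw [matrixRpow, matrixRpow, dif_pos hA, dif_pos hB']
  have specA := hA.spectral_theorem
  have specB := hB'.spectral_theorem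
  rw [Unitary.conjStarAlgAut_apply] at specA specB
  have hV₁ : (star hA.eigenvectorUnitary : Matrix m m ℂ) * (hA.eigenvectorUnitary) = 1 :=
    Unitary.coe_star_mul_self _
  have hV₂ : (hA.eigenvectorUnitary : Matrix m m ℂ) * (star hA.eigenvectorUnitary : Matrix m m ℂ)
      = 1 := Unitary.coe_mul_star_self _
  have hU₁ : (star hB'.eigenvectorUnitary : Matrix n n ℂ) * (hB'.eigenvectorUnitary) = 1 :=
    Unitary.coe_star_mul_self _
  have hU₂ : (hB'.eigenvectorUnitary : Matrix n n ℂ) * (star hB'.eigenvectorUnitary : Matrix n n ℂ)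
      = 1 := Unitary.coe_mul_star_self _
  have hpos := hB.eigenvalues_nonneg
  generalize hA.eigenvalues = μ at *
  generalize hB'.eigenvalues = l at *
  generalize (hA.eigenvectorUnitary : Matrix m m ℂ) = V at *
  generalize (hB'.eigenvectorUnitary : Matrix n n ℂ) = U at *
  have hW : diagonal (fun i => (μ i : ℂ)) * (star V * X * U)
      = (c : ℂ) • ((star V * X * U) * diagonal (fun i => (l i : ℂ))) := by
    calc _ = (star V * V) * diagonal (fun i => (μ i : ℂ)) * (star V * X * U) := by
          rw [hV₁, Matrix.one_mul]
      _ = star V * (A * X) * U := by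
          rw [specA]; simp only [Matrix.mul_assoc]; rfl
      _ = (c : ℂ) • ((star V * X * U) * diagonal (fun i => (l i : ℂ)) * (star U * U)) := by
          rw [h, specB]; simp only [Matrix.mul_assoc, Matrix.mul_smul, Matrix.smul_mul]; rfl
      _ = _ := by rw [hU₁, Matrix.mul_one]
  have hWs : diagonal (fun i => ((μ i ^ s : ℝ) : ℂ)) * (star V * X * U)
      = ((c ^ s : ℝ) : ℂ) • ((star V * X * U) * diagonal (fun i => ((l i ^ s : ℝ) : ℂ))) := by
    ext i j
    have hij := congrFun (congrFun hW i) j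
    simp only [Matrix.diagonal_mul, Matrix.smul_apply, Matrix.mul_diagonal, smul_eq_mul] at hij ⊢
    rcases eq_or_ne ((star V * X * U) i j) 0 with h0 | h0
    · simp [h0]
    · have hμ : μ i = c * l j := by
        have : (μ i : ℂ) = (c : ℂ) * l j := mul_right_cancel₀ h0 (by rw [hij]; ring)
        exact_mod_cast this
      rw [hμ, Real.mul_rpow hc (hpos j)]
      push_cast
      ring
  calc _ = V * (diagonal (fun i => ((μ i ^ s : ℝ) : ℂ)) * (star V * X * U)) * star U := by
        simp only [Matrix.mul_assoc, hU₂, Matrix.mul_one]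
    _ = ((c ^ s : ℝ) : ℂ) • ((V * star V) * (X * (U * diagonal (fun i => ((l i ^ s : ℝ) : ℂ))
          * star U))) := by
        rw [hWs]; simp only [Matrix.mul_assoc, Matrix.mul_smul, Matrix.smul_mul]
    _ = _ := by rw [hV₂, Matrix.one_mul]

theorem Matrix.PosSemidef.matrixRpow {A : Matrix n n ℂ} (hA : A.PosSemidef) (s : ℝ) :
    (matrixRpow A s).PosSemidef := by
  rw [_root_.matrixRpow, dif_pos hA.isHermitian]
  refine PosSemidef.mul_mul_conjTranspose_same (posSemidef_diagonal_iff.2 fun i => ?_) _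
  exact_mod_cast Real.rpow_nonneg (hA.eigenvalues_nonneg i) s

/-- Trace of a power of a compression to the range of the projection `K Kᴴ / 2`. -/
theorem two_rpow_mul_trace_matrixRpow_compression {K Q : Matrix m n ℂ} {P : Matrix m m ℂ}
    {S : Matrix n n ℂ} {s : ℝ} (hs : 0 < s) (hS : S.PosSemidef)
    (hKPK : Kᴴ * P * K = S) (hKK : Kᴴ * K = (2 : ℂ) • 1) (hKQ : Kᴴ * Q = 0)
    (hsum : K * Kᴴ + Q * Qᴴ = (2 : ℂ) • 1) :
    (((2 : ℝ) ^ s : ℝ) : ℂ) *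
        (matrixRpow ((1 / 2 : ℂ) • (K * Kᴴ) * P * ((1 / 2 : ℂ) • (K * Kᴴ))) s).trace
      = (matrixRpow S s).trace := by
  have hM : (1 / 2 : ℂ) • (K * Kᴴ) * P * ((1 / 2 : ℂ) • (K * Kᴴ)) = (1 / 4 : ℂ) • (K * S * Kᴴ) := by
    rw [← hKPK]
    simp only [Matrix.mul_assoc, Matrix.mul_smul, Matrix.smul_mul, smul_smul]
    norm_num
  rw [hM]
  have hMH : ((1 / 4 : ℂ) • (K * S * Kᴴ)).IsHermitian := by
    rw [IsHermitian, conjTranspose_smul, (isHermitian_mul_mul_conjTranspose K hS.isHermitian).eq]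
    norm_num
  set M := (1 / 4 : ℂ) • (K * S * Kᴴ) with hMdef
  have hMK : M * K = (((1 / 2 : ℝ)) : ℂ) • (K * S) := by
    rw [hMdef, Matrix.smul_mul, Matrix.mul_assoc, hKK, Matrix.mul_smul, Matrix.mul_one, smul_smul]
    norm_num
  have hMQ : M * Q = ((0 : ℝ) : ℂ) • (Q * S) := by
    rw [hMdef, Matrix.smul_mul, Matrix.mul_assoc, hKQ]
    simp
  have hK := matrixRpow_mul_eq_smul_mul_matrixRpow hMH hS (by norm_num) hMK s
  have hQ := matrixRpow_mul_eq_smul_mul_matrixRpow hMH hS le_rfl hMQ s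
  rw [Real.zero_rpow hs.ne', Complex.ofReal_zero, zero_smul] at hQ
  have htr : 2 * (matrixRpow M s).trace
      = (((1 / 2 : ℝ) ^ s : ℝ) : ℂ) * (2 * (matrixRpow S s).trace) := by
    calc _ = (matrixRpow M s * ((2 : ℂ) • 1)).trace := by simp
      _ = ((((1 / 2 : ℝ) ^ s : ℝ) : ℂ) • (K * matrixRpow S s * Kᴴ)).trace := by
          rw [← hsum, Matrix.mul_add, ← Matrix.mul_assoc, ← Matrix.mul_assoc, hK, hQ,
            Matrix.zero_mul, add_zero, Matrix.smul_mul]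
      _ = _ := by
          rw [trace_smul, trace_mul_cycle, hKK]
          simp
  have h2 : (((2 : ℝ) ^ s : ℝ) : ℂ) * (((1 / 2 : ℝ) ^ s : ℝ) : ℂ) = 1 := by
    rw [← Complex.ofReal_mul, ← Real.mul_rpow (by norm_num) (by norm_num)]
    norm_num
  linear_combination ((((2 : ℝ) ^ s : ℝ) : ℂ) / 2) * htr + (matrixRpow S s).trace * h2

end MatrixRpow

section BlockColumn

variable {n : Type*} [DecidableEq n]

/-- The block column with blocks `a • 1` and `b • 1`. -/
def blockColumn (n : Type*) [DecidableEq n] (a b : ℂ) : Matrix (Fin 2 × n) n ℂ :=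
  Matrix.of fun x j => if x.2 = j then (if x.1 = 0 then a else b) else 0

theorem blockColumn_conjTranspose_mul [Fintype n] (a b a' b' : ℂ) :
    (blockColumn n a b)ᴴ * blockColumn n a' b' = (star a * a' + star b * b') • 1 := by
  ext i j
  rcases eq_or_ne i j with rfl | h
  · simp [blockColumn, Matrix.mul_apply, Fintype.sum_prod_type, apply_ite (starRingEnd ℂ)]
  · simp [blockColumn, Matrix.mul_apply, Fintype.sum_prod_type, apply_ite (starRingEnd ℂ), h, h.symm]

theorem blockColumn_eq_add (a b : ℂ) :
    blockColumn n a b = a • blockColumn n 1 0 + b • blockColumn n 0 1 := by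
  ext ⟨i, k⟩ j
  fin_cases i <;> simp [blockColumn]

theorem blockColumn_mul_conjTranspose [Fintype n] (a b : ℂ) :
    blockColumn n a b * (blockColumn n a b)ᴴ = Matrix.of fun x y => if x.2 = y.2 then
      (if x.1 = 0 then a else b) * star (if y.1 = 0 then a else b) else 0 := by
  ext ⟨i, k⟩ ⟨j, l⟩
  simp only [blockColumn, Matrix.mul_apply, conjTranspose_apply, of_apply]
  rw [Finset.sum_eq_single k (fun x _ hx => by simp [hx.symm]) (by simp)]
  by_cases h : k = l
  · simp [h]
  · simp [h, Ne.symm h]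

end BlockColumn

/-- **The pinching identity behind the proof of concavity of `Φ_p`:** with
`𝒜 = diag(A₁, A₂)` on `ℂ² ⊗ ℂ^d`, `σ` the block swap, and `Π± = (1 ± σ)/2` the
complementary orthogonal projections,
`2 Tr((A₁^p + A₂^p)^{1/p}) = 2^{1/p} Tr((Π₊ 𝒜^p Π₊)^{1/p}) + 2^{1/p} Tr((Π₋ 𝒜^p Π₋)^{1/p})`. -/
theorem pinching_identity {d : ℕ} (p : ℝ) (hp : 0 < p)
    (A₁ A₂ : Matrix (Fin d) (Fin d) ℂ) (h₁ : A₁.PosSemidef) (h₂ : A₂.PosSemidef)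
    (𝒜 σ : Matrix (Fin 2 × Fin d) (Fin 2 × Fin d) ℂ)
    (h𝒜 : 𝒜 = Matrix.of fun x y =>
      if x.1 = y.1 then (if x.1 = 0 then A₁ x.2 y.2 else A₂ x.2 y.2) else 0)
    (hσ : σ = Matrix.of fun x y => if x.2 = y.2 ∧ x.1 ≠ y.1 then 1 else 0) :
    2 * (matrixRpow (matrixRpow A₁ p + matrixRpow A₂ p) (1 / p)).trace
      = (((2 : ℝ) ^ (1 / p) : ℝ) : ℂ) *
          (matrixRpow ((1 / 2 : ℂ) • (1 + σ) * matrixRpow 𝒜 p * ((1 / 2 : ℂ) • (1 + σ)))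
              (1 / p)).trace
        + (((2 : ℝ) ^ (1 / p) : ℝ) : ℂ) *
          (matrixRpow ((1 / 2 : ℂ) • (1 - σ) * matrixRpow 𝒜 p * ((1 / 2 : ℂ) • (1 - σ)))
              (1 / p)).trace := by
  have h𝒜H : 𝒜.IsHermitian := by
    ext ⟨i, k⟩ ⟨j, l⟩
    have e₁ := h₁.isHermitian.apply k l
    have e₂ := h₂.isHermitian.apply k l
    fin_cases i <;> fin_cases j <;> simp_all
  have hJ₁ : 𝒜 * blockColumn (Fin d) 1 0 = ((1 : ℝ) : ℂ) • (blockColumn (Fin d) 1 0 * A₁) := by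
    ext ⟨i, k⟩ j
    fin_cases i <;> simp [h𝒜, blockColumn, Matrix.mul_apply, Fintype.sum_prod_type]
  have hJ₂ : 𝒜 * blockColumn (Fin d) 0 1 = ((1 : ℝ) : ℂ) • (blockColumn (Fin d) 0 1 * A₂) := by
    ext ⟨i, k⟩ j
    fin_cases i <;> simp [h𝒜, blockColumn, Matrix.mul_apply, Fintype.sum_prod_type]
  have hP₁ := matrixRpow_mul_eq_smul_mul_matrixRpow h𝒜H h₁ zero_le_one hJ₁ p
  have hP₂ := matrixRpow_mul_eq_smul_mul_matrixRpow h𝒜H h₂ zero_le_one hJ₂ p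
  rw [Real.one_rpow, Complex.ofReal_one, one_smul] at hP₁ hP₂
  have hcomp : ∀ ε : ℂ, star ε * ε = 1 →
      (blockColumn (Fin d) 1 ε)ᴴ * matrixRpow 𝒜 p * blockColumn (Fin d) 1 ε
        = matrixRpow A₁ p + matrixRpow A₂ p := by
    intro ε hε
    rw [Matrix.mul_assoc, blockColumn_eq_add 1 ε, Matrix.mul_add, Matrix.mul_smul,
      Matrix.mul_smul, hP₁, hP₂, ← blockColumn_eq_add 1 ε, Matrix.mul_add, Matrix.mul_smul,
      Matrix.mul_smul, ← Matrix.mul_assoc, ← Matrix.mul_assoc, blockColumn_conjTranspose_mul,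
      blockColumn_conjTranspose_mul]
    simp only [star_one, mul_one, mul_zero, add_zero, zero_add, one_smul, Matrix.one_mul,
      Matrix.smul_mul, smul_smul]
    rw [mul_comm, hε, one_smul]
  have hplus : 1 + σ = blockColumn (Fin d) 1 1 * (blockColumn (Fin d) 1 1)ᴴ := by
    rw [blockColumn_mul_conjTranspose, hσ]
    ext ⟨i, k⟩ ⟨j, l⟩
    fin_cases i <;> fin_cases j <;> simp [Matrix.one_apply]
  have hminus : 1 - σ = blockColumn (Fin d) 1 (-1) * (blockColumn (Fin d) 1 (-1))ᴴ := by
    rw [blockColumn_mul_conjTranspose, hσ]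
    ext ⟨i, k⟩ ⟨j, l⟩
    fin_cases i <;> fin_cases j <;> simp [Matrix.one_apply, neg_ite]
  have hsum : (1 + σ) + (1 - σ) = (2 : ℂ) • 1 := by
    rw [two_smul]; abel
  have hS := (h₁.matrixRpow p).add (h₂.matrixRpow p)
  rw [hplus, hminus] at hsum ⊢
  rw [two_rpow_mul_trace_matrixRpow_compression (one_div_pos.2 hp) hS (hcomp 1 (by simp))
      (by rw [blockColumn_conjTranspose_mul]; norm_num)
      (by rw [blockColumn_conjTranspose_mul]; norm_num) hsum,
    two_rpow_mul_trace_matrixRpow_compression (one_div_pos.2 hp) hS (hcomp (-1) (by simp))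
      (by rw [blockColumn_conjTranspose_mul]; norm_num)
      (by rw [blockColumn_conjTranspose_mul]; norm_num) ((add_comm _ _).trans hsum),
    two_mul]
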